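/- Let 0 < p < q < ∞. Then for every entire function f with ‖f‖_{F,p} < ∞ one has ‖f‖_{F,q} ≤ ‖f‖_{F,p}, with equality if and only if f = 0 or ‖f‖_{F,p}⁻¹ f ∈ M₁. -/

import Mathlib

open MeasureTheory

/-- The `p`-Fock norm `‖f‖_{F,p} = ((p/2) ∫_ℂ |f(z)|^p e^{−pπ|z|²/2} dA(z))^{1/p}`. -/
noncomputable def fockNorm (p : ℝ) (f : ℂ → ℂ) : ℝ :=
  ((p/2) * ∫ z : ℂ, ‖f z‖ ^ p * Real.exp (-p * Real.pi * ‖z‖^2 / 2)) ^ (1/p)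

/-- The optimizer set `M₁`: the functions `z ↦ e^{iθ} e^{−π|w|²/2 + π conj(w) z}`. -/
def fockOpt : Set (ℂ → ℂ) :=
  {f | ∃ w : ℂ, ∃ θ : ℝ, f = fun z =>
    Complex.exp (Complex.I * (θ:ℂ)) *
      Complex.exp (((-Real.pi * ‖w‖^2 / 2 : ℝ) : ℂ) + (Real.pi : ℂ) * (starRingEnd ℂ) w * z)}

section SubmeanValue

open Real Metric Filter

/-- The uniform probability measure on the angles `(0, 2π]`. -/
noncomputable def angleMeasure : Measure ℝ :=
  (ENNReal.ofReal (2 * π))⁻¹ • volume.restrict (Set.Ioc 0 (2 * π))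

instance : IsProbabilityMeasure angleMeasure := by
  constructor
  have h : ENNReal.ofReal (2 * π) ≠ 0 := by simpa using pi_pos
  simp only [angleMeasure, Measure.smul_apply, Measure.restrict_apply_univ, Real.volume_Ioc,
    sub_zero, smul_eq_mul]
  exact ENNReal.inv_mul_cancel h ENNReal.ofReal_ne_top

lemma circleAverage_eq_integral_angleMeasure (f : ℂ → ℝ) :
    circleAverage f 0 1 = ∫ θ, f (circleMap 0 1 θ) ∂angleMeasure := by
  rw [circleAverage_def, angleMeasure, integral_smul_measure,
    intervalIntegral.integral_of_le two_pi_pos.le, ENNReal.toReal_inv,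
    ENNReal.toReal_ofReal two_pi_pos.le]

lemma CircleIntegrable.integrable_angleMeasure {f : ℂ → ℝ} (hf : CircleIntegrable f 0 1) :
    Integrable (fun θ ↦ f (circleMap 0 1 θ)) angleMeasure := by
  have h : ENNReal.ofReal (2 * π) ≠ 0 := by simpa using pi_pos
  exact ((intervalIntegrable_iff_integrableOn_Ioc_of_le two_pi_pos.le).1 hf).smul_measure
    (ENNReal.inv_ne_top.2 h)

lemma log_norm_le_circleAverage {g : ℂ → ℂ} (hg : Differentiable ℂ g) (h0 : g 0 ≠ 0) :
    log ‖g 0‖ ≤ circleAverage (log ‖g ·‖) 0 1 := by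
  have hA : AnalyticOnNhd ℂ g (closedBall 0 |1|) := fun z _ ↦ hg.analyticAt z
  rw [hA.circleAverage_log_norm one_ne_zero h0]
  refine le_add_of_nonneg_left (finsum_nonneg fun u ↦ ?_)
  by_cases hu : u ∈ closedBall (0 : ℂ) |1|
  · refine mul_nonneg (mod_cast MeromorphicOn.AnalyticOnNhd.divisor_nonneg hA u) ?_
    by_cases hu0 : u = 0
    · simp [hu0]
    apply log_nonneg
    have : ‖u‖ ≤ 1 := by simpa using hu
    simpa using (one_le_inv₀ (norm_pos_iff.mpr hu0)).2 this
  · rw [Function.locallyFinsuppWithin.apply_eq_zero_of_notMem _ hu]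
    simp

lemma ae_ne_zero_circleMap {g : ℂ → ℂ} (hg : Differentiable ℂ g) (h0 : g 0 ≠ 0) :
    ∀ᵐ θ ∂angleMeasure, g (circleMap 0 1 θ) ≠ 0 := by
  have h1 : g ⁻¹' {0}ᶜ ∈ codiscrete ℂ :=
    AnalyticOnNhd.preimage_zero_mem_codiscrete (x := 0) (fun z _ ↦ hg.analyticAt z) h0
  have h2 : g ⁻¹' {0}ᶜ ∈ codiscreteWithin (sphere (0 : ℂ) |1|) :=
    codiscreteWithin_mono (Set.subset_univ _) h1
  have h3 := circleMap_preimage_codiscrete one_ne_zero h2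
  refine Measure.ae_smul_measure ?_ _
  exact ae_restrict_le_codiscreteWithin measurableSet_Ioc
    (codiscreteWithin_mono (Set.subset_univ _) h3)

lemma rpow_tangent_le {x m α : ℝ} (hx : 0 < x) :
    exp (α * m) * (1 + α * (log x - m)) ≤ x ^ α := by
  rw [rpow_def_of_pos hx, show log x * α = α * m + α * (log x - m) by ring, exp_add]
  gcongr
  linarith [add_one_le_exp (α * (log x - m))]

lemma log_eq_of_rpow_tangent_eq {x m α : ℝ} (hα : 0 < α) (hx : 0 < x)
    (h : x ^ α = exp (α * m) * (1 + α * (log x - m))) : log x = m := by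
  rw [rpow_def_of_pos hx, show log x * α = α * m + α * (log x - m) by ring, exp_add] at h
  have h' := mul_left_cancel₀ (exp_pos _).ne' h
  by_contra hne
  have := add_one_lt_exp (mul_ne_zero hα.ne' (sub_ne_zero.mpr hne))
  linarith

lemma norm_rpow_submean_of_ne_zero {g : ℂ → ℂ} (hg : Differentiable ℂ g) (h0 : g 0 ≠ 0)
    {α : ℝ} (hα : 0 < α) :
    ‖g 0‖ ^ α ≤ ∫ θ, ‖g (circleMap 0 1 θ)‖ ^ α ∂angleMeasure ∧
      (∫ θ, ‖g (circleMap 0 1 θ)‖ ^ α ∂angleMeasure ≤ ‖g 0‖ ^ α → ‖g 1‖ = ‖g 0‖) := by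
  set m := log ‖g 0‖ with hm
  have hpos : 0 < ‖g 0‖ := norm_pos_iff.mpr h0
  have hem : exp (α * m) = ‖g 0‖ ^ α := by rw [rpow_def_of_pos hpos, mul_comm]
  have hc : Continuous fun z ↦ ‖g z‖ ^ α :=
    hg.continuous.norm.rpow_const fun _ ↦ Or.inr hα.le
  have hi1 : Integrable (fun θ ↦ ‖g (circleMap 0 1 θ)‖ ^ α) angleMeasure :=
    (hc.continuousOn.circleIntegrable' : CircleIntegrable _ 0 1).integrable_angleMeasure
  have hil : Integrable (fun θ ↦ log ‖g (circleMap 0 1 θ)‖) angleMeasure :=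
    (MeromorphicOn.circleIntegrable_log_norm
      fun z _ ↦ (hg.analyticAt z).meromorphicAt).integrable_angleMeasure
  have hil' : Integrable (fun θ ↦ α * (log ‖g (circleMap 0 1 θ)‖ - m)) angleMeasure :=
    (hil.sub (integrable_const m)).const_mul α
  have hi2 : Integrable
      (fun θ ↦ exp (α * m) * (1 + α * (log ‖g (circleMap 0 1 θ)‖ - m))) angleMeasure :=
    ((integrable_const 1).add hil').const_mul _
  have hle : ∀ᵐ θ ∂angleMeasure,
      exp (α * m) * (1 + α * (log ‖g (circleMap 0 1 θ)‖ - m)) ≤ ‖g (circleMap 0 1 θ)‖ ^ α := by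
    filter_upwards [ae_ne_zero_circleMap hg h0] with θ hθ
    exact rpow_tangent_le (norm_pos_iff.mpr hθ)
  have hval : ‖g 0‖ ^ α ≤
      ∫ θ, exp (α * m) * (1 + α * (log ‖g (circleMap 0 1 θ)‖ - m)) ∂angleMeasure := by
    have hJ := log_norm_le_circleAverage hg h0
    rw [circleAverage_eq_integral_angleMeasure] at hJ
    rw [integral_const_mul, integral_add (integrable_const _) hil', integral_const_mul,
      integral_sub hil (integrable_const m), hem]
    simp only [integral_const, probReal_univ, smul_eq_mul, one_mul]
    exact le_mul_of_one_le_right (by positivity)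
      (le_add_of_nonneg_right (mul_nonneg hα.le (sub_nonneg.2 hJ)))
  refine ⟨hval.trans (integral_mono_ae hi2 hi1 hle), fun h ↦ ?_⟩
  have hae := (integral_eq_iff_of_ae_le hi2 hi1 hle).1
    (le_antisymm (integral_mono_ae hi2 hi1 hle) (h.trans hval))
  have hae' : ∀ᵐ θ ∂angleMeasure, ‖g (circleMap 0 1 θ)‖ = ‖g 0‖ := by
    filter_upwards [hae, ae_ne_zero_circleMap hg h0] with θ h1 h2
    exact log_injOn_pos (norm_pos_iff.mpr h2) hpos
      (log_eq_of_rpow_tangent_eq hα (norm_pos_iff.mpr h2) h1.symm)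
  have hae2 : ∀ᵐ θ ∂(volume.restrict (Set.Ioc 0 (2 * π))),
      ‖g (circleMap 0 1 θ)‖ = ‖g 0‖ := by
    exact (Measure.ae_ennreal_smul_measure_iff
      (ENNReal.inv_ne_zero.2 ENNReal.ofReal_ne_top)).1 hae'
  have h2 := Measure.eqOn_Ioc_of_ae_eq volume hae2
    (hg.continuous.comp (continuous_circleMap 0 1)).norm.continuousOn continuousOn_const
    (Set.right_mem_Ioc.2 two_pi_pos)
  simpa [circleMap] using h2

lemma enorm_rpow_submean {g : ℂ → ℂ} (hg : Differentiable ℂ g) {α : ℝ} (hα : 0 < α) :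
    ‖g 0‖ₑ ^ α ≤ ∫⁻ θ, ‖g (circleMap 0 1 θ)‖ₑ ^ α ∂angleMeasure ∧
      (∫⁻ θ, ‖g (circleMap 0 1 θ)‖ₑ ^ α ∂angleMeasure ≤ ‖g 0‖ₑ ^ α → g 0 ≠ 0 →
        ‖g 1‖ = ‖g 0‖) := by
  by_cases h0 : g 0 = 0
  · simp [h0, hα]
  have hc : Continuous fun z ↦ ‖g z‖ ^ α :=
    hg.continuous.norm.rpow_const fun _ ↦ Or.inr hα.le
  have hi1 : Integrable (fun θ ↦ ‖g (circleMap 0 1 θ)‖ ^ α) angleMeasure :=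
    (hc.continuousOn.circleIntegrable' : CircleIntegrable _ 0 1).integrable_angleMeasure
  have key (w : ℂ) : ‖w‖ₑ ^ α = ENNReal.ofReal (‖w‖ ^ α) := by
    rw [← ofReal_norm, ENNReal.ofReal_rpow_of_nonneg (norm_nonneg _) hα.le]
  have hI : ∫⁻ θ, ‖g (circleMap 0 1 θ)‖ₑ ^ α ∂angleMeasure =
      ENNReal.ofReal (∫ θ, ‖g (circleMap 0 1 θ)‖ ^ α ∂angleMeasure) := by
    rw [ofReal_integral_eq_lintegral_ofReal hi1 (ae_of_all _ fun θ ↦ by positivity)]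
    simp_rw [key]
  obtain ⟨h1, h2⟩ := norm_rpow_submean_of_ne_zero hg h0 hα
  rw [hI, key]
  refine ⟨ENNReal.ofReal_le_ofReal h1, fun h _ ↦ h2 ?_⟩
  exact (ENNReal.ofReal_le_ofReal_iff (by positivity)).1 h

end SubmeanValue

section ComplexGaussian

open Real Complex RealInnerProductSpace

/-- The standard complex Gaussian probability measure, with density `e^{-π|z|²}`. -/
noncomputable def complexGaussian : Measure ℂ :=
  volume.withDensity fun z ↦ ENNReal.ofReal (Real.exp (-π * ‖z‖ ^ 2))

lemma measurable_complexGaussian_density :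
    Measurable fun z : ℂ ↦ ENNReal.ofReal (Real.exp (-π * ‖z‖ ^ 2)) := by fun_prop

instance : IsProbabilityMeasure complexGaussian := by
  constructor
  have h1 := GaussianFourier.integral_rexp_neg_mul_sq_norm (V := ℂ) pi_pos
  rw [div_self pi_pos.ne', one_rpow] at h1
  have h2 : Integrable fun z : ℂ ↦ Real.exp (-π * ‖z‖ ^ 2) := by
    by_contra h
    rw [integral_undef h] at h1
    exact zero_ne_one h1
  rw [complexGaussian, withDensity_apply _ MeasurableSet.univ, Measure.restrict_univ,
    ← ofReal_integral_eq_lintegral_ofReal h2 (ae_of_all _ fun z ↦ (Real.exp_pos _).le), h1,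
    ENNReal.ofReal_one]

instance : complexGaussian.IsOpenPosMeasure :=
  (withDensity_absolutelyContinuous' measurable_complexGaussian_density.aemeasurable
    (ae_of_all _ fun z ↦ by simp [Real.exp_pos])).isOpenPosMeasure

lemma charFun_complexGaussian (t : ℂ) :
    charFun complexGaussian t = cexp (-(‖t‖ ^ 2 / (4 * π) : ℝ)) := by
  have h := GaussianFourier.integral_cexp_neg_mul_sq_norm_add (V := ℂ) (b := π)
    (by simpa using pi_pos) I t
  rw [charFun_apply, complexGaussian, integral_withDensity_eq_integral_toReal_smul
    measurable_complexGaussian_density (by simp)]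
  have hpi : (π : ℂ) ≠ 0 := by exact_mod_cast pi_pos.ne'
  rw [div_self hpi, one_cpow, one_mul, I_sq] at h
  refine (integral_congr_ae (ae_of_all _ fun v ↦ ?_)).trans (h.trans ?_)
  · rw [ENNReal.toReal_ofReal (Real.exp_pos _).le, real_smul, ofReal_exp, ← Complex.exp_add,
      real_inner_comm]
    push_cast
    ring_nf
  · push_cast
    ring_nf

variable {ι : Type*} [Fintype ι]

lemma integral_cexp_sum_inner (s : ι → ℂ) :
    ∫ x : ι → ℂ, cexp ((∑ i, ⟪x i, s i⟫ : ℝ) * I) ∂(Measure.pi fun _ ↦ complexGaussian) =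
      cexp (-((∑ i, ‖s i‖ ^ 2) / (4 * π) : ℝ)) := by
  have h := charFun_pi (μ := fun _ : ι ↦ complexGaussian) (WithLp.toLp 2 s)
  simp_rw [charFun_complexGaussian, ← Complex.exp_sum] at h
  rw [charFun_apply, ← MeasurableEquiv.coe_toLp, integral_map_equiv] at h
  simp only [MeasurableEquiv.coe_toLp, PiLp.inner_apply] at h
  rw [h]
  push_cast
  rw [Finset.sum_neg_distrib, Finset.sum_div]

lemma map_sum_smul_complexGaussian (a : ι → ℝ) (ha : ∑ i, a i ^ 2 = 1) :
    (Measure.pi fun _ : ι ↦ complexGaussian).map (fun x ↦ ∑ i, (a i : ℂ) * x i) =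
      complexGaussian := by
  have hm : Measurable fun x : ι → ℂ ↦ ∑ i, (a i : ℂ) * x i := by fun_prop
  have := Measure.isProbabilityMeasure_map
    (μ := Measure.pi fun _ : ι ↦ complexGaussian) hm.aemeasurable
  refine Measure.ext_of_charFun (funext fun t ↦ ?_)
  rw [charFun_complexGaussian, charFun_apply, integral_map hm.aemeasurable (by fun_prop)]
  convert integral_cexp_sum_inner (fun i ↦ (a i : ℂ) * t) using 5
  · rw [sum_inner]
    congr 1
    refine Finset.sum_congr rfl fun i _ ↦ ?_
    rw [← real_smul, ← real_smul, real_inner_smul_left, real_inner_smul_right]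
  · simp_rw [norm_mul, mul_pow, ← Finset.sum_mul]
    simp [ha]

/-- Rotation of a vector by the scalar `c`, around its diagonal part. -/
noncomputable def rotateAboutMean (c : ℂ) (x : ι → ℂ) (i : ι) : ℂ :=
  (∑ j, x j) / Fintype.card ι + c * (x i - (∑ j, x j) / Fintype.card ι)

lemma sum_norm_sq_rotateAboutMean [Nonempty ι] {c : ℂ} (hc : ‖c‖ = 1) (t : ι → ℂ) :
    ∑ i, ‖rotateAboutMean c t i‖ ^ 2 = ∑ i, ‖t i‖ ^ 2 := by
  have key (c : ℂ) (hc : ‖c‖ = 1) : ∑ i, ‖rotateAboutMean c t i‖ ^ 2 =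
      ∑ i : ι, ‖(∑ j, t j) / Fintype.card ι‖ ^ 2 +
        ∑ i, ‖t i - (∑ j, t j) / Fintype.card ι‖ ^ 2 := by
    set m := (∑ j, t j) / Fintype.card ι with hm
    have h0 : ∑ i, (t i - m) = 0 := by
      rw [Finset.sum_sub_distrib, Finset.sum_const, Finset.card_univ, nsmul_eq_mul, hm,
        mul_div_cancel₀ _ (by simp), sub_self]
    have h1 : ∑ i, ⟪m, c * (t i - m)⟫ = 0 := by
      rw [← inner_sum, ← Finset.mul_sum, h0, mul_zero, inner_zero_right]
    simp_rw [rotateAboutMean, ← hm, norm_add_sq_real, norm_mul, hc, one_mul,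
      Finset.sum_add_distrib, ← Finset.mul_sum, h1]
    ring
  rw [key c hc, ← key 1 norm_one]
  simp [rotateAboutMean]

lemma sum_inner_rotateAboutMean [Nonempty ι] (c : ℂ) (x t : ι → ℂ) :
    ∑ i, ⟪rotateAboutMean c x i, t i⟫ =
      ∑ i, ⟪x i, rotateAboutMean (starRingEnd ℂ c) t i⟫ := by
  simp_rw [Complex.inner, ← Complex.re_sum, rotateAboutMean]
  congr 1
  have hn : (Fintype.card ι : ℂ) ≠ 0 := by simp
  simp only [map_add, map_mul, map_sub, map_div₀, map_sum, map_natCast, add_mul, mul_add, sub_mul,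
    mul_sub, Finset.sum_add_distrib, Finset.sum_sub_distrib, mul_assoc, ← Finset.mul_sum,
    ← Finset.sum_mul, mul_left_comm _ (starRingEnd ℂ c)]
  field_simp

lemma measurePreserving_rotateAboutMean [Nonempty ι] {c : ℂ} (hc : ‖c‖ = 1) :
    MeasurePreserving (rotateAboutMean c) (Measure.pi fun _ : ι ↦ complexGaussian)
      (Measure.pi fun _ : ι ↦ complexGaussian) := by
  have hm : Measurable (rotateAboutMean c : (ι → ℂ) → ι → ℂ) := by
    unfold rotateAboutMean; fun_prop
  refine ⟨hm, ?_⟩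
  have := Measure.isProbabilityMeasure_map
    (μ := Measure.pi fun _ : ι ↦ complexGaussian) hm.aemeasurable
  refine charFun_eq_pi_iff.1 fun t ↦ ?_
  rw [← charFun_pi, charFun_apply, charFun_apply, ← MeasurableEquiv.coe_toLp,
    integral_map_equiv, integral_map_equiv, integral_map hm.aemeasurable]
  · simp only [MeasurableEquiv.coe_toLp, PiLp.inner_apply]
    simp_rw [sum_inner_rotateAboutMean]
    rw [integral_cexp_sum_inner, integral_cexp_sum_inner,
      sum_norm_sq_rotateAboutMean (by simpa using hc)]
  · simp only [MeasurableEquiv.coe_toLp, PiLp.inner_apply]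
    exact Continuous.aestronglyMeasurable (by fun_prop)

end ComplexGaussian

section LoomisWhitney

open scoped ENNReal

variable {ι X : Type*} [DecidableEq ι] [MeasurableSpace X]

/-- A function independent of the `i`-th variable keeps this property after marginalisation. -/
lemma lmarginal_update_of_forall_update {μ : Measure X} [SigmaFinite μ] {F : (ι → X) → ℝ≥0∞}
    {i : ι} (hF : Measurable F) (h : ∀ x y, F (Function.update x i y) = F x) (s : Finset ι)
    (x : ι → X) (y : X) :
    lmarginal (fun _ ↦ μ) s F (Function.update x i y) = lmarginal (fun _ ↦ μ) s F x := by
  by_cases hi : i ∈ s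
  · exact lmarginal_update_of_mem _ hi F x y
  · rw [lmarginal_update_of_notMem hF hi]
    congr 1
    ext z
    exact h z y

variable [Fintype ι]

lemma lmarginal_prod_rpow_le {μ : Measure X} [IsProbabilityMeasure μ]
    {F : ι → (ι → X) → ℝ≥0∞} (hF : ∀ i, Measurable (F i))
    (hd : ∀ i x y, F i (Function.update x i y) = F i x)
    {c : ℝ} (hc : 0 ≤ c) (hcard : (Fintype.card ι - 1) * c = 1) (s : Finset ι) :
    lmarginal (fun _ ↦ μ) s (fun x ↦ ∏ i, F i x ^ c) ≤
      fun x ↦ ∏ i, (lmarginal (fun _ ↦ μ) s (F i) x) ^ c := by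
  have hprod : Measurable fun x ↦ ∏ i, F i x ^ c :=
    Finset.measurable_prod _ fun i _ ↦ (hF i).pow_const c
  induction s using Finset.induction with
  | empty => simp
  | insert j s hj ih =>
    intro x
    rw [lmarginal_insert _ hprod hj]
    have hG (i : ι) : Measurable (lmarginal (fun _ ↦ μ) s (F i)) := (hF i).lmarginal _
    calc ∫⁻ y, lmarginal (fun _ ↦ μ) s (fun x ↦ ∏ i, F i x ^ c) (Function.update x j y) ∂μ
      _ ≤ ∫⁻ y, ∏ i, (lmarginal (fun _ ↦ μ) s (F i) (Function.update x j y)) ^ c ∂μ :=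
          lintegral_mono fun y ↦ ih _
      _ = ∫⁻ y, (lmarginal (fun _ ↦ μ) s (F j) x) ^ c * ∏ i ∈ Finset.univ.erase j,
            (lmarginal (fun _ ↦ μ) s (F i) (Function.update x j y)) ^ c ∂μ := by
          congr! 2 with y
          rw [← Finset.mul_prod_erase _ _ (Finset.mem_univ j),
            lmarginal_update_of_forall_update (hF j) (hd j)]
      _ = (lmarginal (fun _ ↦ μ) s (F j) x) ^ c * ∫⁻ y, ∏ i ∈ Finset.univ.erase j,
            (lmarginal (fun _ ↦ μ) s (F i) (Function.update x j y)) ^ c ∂μ := by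
          refine lintegral_const_mul _ (Finset.measurable_prod _ fun i _ ↦ ?_)
          exact ((hG i).comp (measurable_update x)).pow_const c
      _ ≤ (lmarginal (fun _ ↦ μ) s (F j) x) ^ c * ∏ i ∈ Finset.univ.erase j,
            (∫⁻ y, lmarginal (fun _ ↦ μ) s (F i) (Function.update x j y) ∂μ) ^ c := by
          gcongr
          refine ENNReal.lintegral_prod_norm_pow_le _
            (fun i _ ↦ ((hG i).comp (measurable_update x)).aemeasurable) ?_ fun _ _ ↦ hc
          rw [Finset.sum_const, Finset.card_erase_of_mem (Finset.mem_univ j), nsmul_eq_mul,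
            Finset.card_univ, Nat.cast_pred (Fintype.card_pos_iff.2 ⟨j⟩), hcard]
      _ = ∏ i, (lmarginal (fun _ ↦ μ) (insert j s) (F i) x) ^ c := by
          rw [← Finset.mul_prod_erase _ _ (Finset.mem_univ j)]
          simp_rw [lmarginal_insert _ (hF _) hj,
            lmarginal_update_of_forall_update (hF j) (hd j)]
          simp

/-- The **Loomis–Whitney inequality** for a product of probability measures. -/
lemma lintegral_prod_rpow_le_of_update {μ : Measure X} [IsProbabilityMeasure μ]
    {F : ι → (ι → X) → ℝ≥0∞} (hF : ∀ i, Measurable (F i))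
    (hd : ∀ i x y, F i (Function.update x i y) = F i x)
    {c : ℝ} (hc : 0 ≤ c) (hcard : (Fintype.card ι - 1) * c = 1) :
    ∫⁻ x, ∏ i, F i x ^ c ∂(Measure.pi fun _ ↦ μ) ≤
      ∏ i, (∫⁻ x, F i x ∂(Measure.pi fun _ ↦ μ)) ^ c := by
  obtain ⟨x⟩ : Nonempty (ι → X) :=
    ⟨fun _ ↦ (nonempty_of_isProbabilityMeasure μ).some⟩
  simpa [lmarginal_univ] using lmarginal_prod_rpow_le (μ := μ) hF hd hc hcard Finset.univ x

end LoomisWhitney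

section RotationAveraging

open scoped ENNReal

variable {ι : Type*} [Fintype ι]

@[simp] lemma rotateAboutMean_one (x : ι → ℂ) : rotateAboutMean 1 x = x := by
  ext i; simp [rotateAboutMean]

@[simp] lemma rotateAboutMean_zero (x : ι → ℂ) :
    rotateAboutMean 0 x = fun _ ↦ (∑ j, x j) / Fintype.card ι := by
  ext i; simp [rotateAboutMean]

lemma differentiable_rotateAboutMean (x : ι → ℂ) :
    Differentiable ℂ fun c ↦ rotateAboutMean c x := by
  unfold rotateAboutMean; fun_prop

lemma continuous_rotateAboutMean_uncurry :
    Continuous fun p : (ι → ℂ) × ℂ ↦ rotateAboutMean p.2 p.1 := by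
  unfold rotateAboutMean; fun_prop

variable [Nonempty ι] {H : (ι → ℂ) → ℂ} {α : ℝ}

lemma lintegral_circle_rotateAboutMean (hH : Differentiable ℂ H) :
    ∫⁻ x, (∫⁻ θ, ‖H (rotateAboutMean (circleMap 0 1 θ) x)‖ₑ ^ α ∂angleMeasure)
      ∂(Measure.pi fun _ : ι ↦ complexGaussian) =
    ∫⁻ x, ‖H x‖ₑ ^ α ∂(Measure.pi fun _ : ι ↦ complexGaussian) := by
  have hmeas : Measurable fun x ↦ ‖H x‖ₑ ^ α :=
    hH.continuous.measurable.enorm.pow_const α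
  have hcont : Continuous fun p : (ι → ℂ) × ℝ ↦
      H (rotateAboutMean (circleMap 0 1 p.2) p.1) :=
    hH.continuous.comp (continuous_rotateAboutMean_uncurry.comp
      (continuous_fst.prodMk ((continuous_circleMap 0 1).comp continuous_snd)))
  rw [lintegral_lintegral_swap (hcont.measurable.enorm.pow_const α).aemeasurable]
  have hθ (θ : ℝ) : ∫⁻ x, ‖H (rotateAboutMean (circleMap 0 1 θ) x)‖ₑ ^ α
      ∂(Measure.pi fun _ : ι ↦ complexGaussian) =
      ∫⁻ x, ‖H x‖ₑ ^ α ∂(Measure.pi fun _ : ι ↦ complexGaussian) :=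
    (measurePreserving_rotateAboutMean (by simp [circleMap])).lintegral_comp hmeas
  simp [hθ]

lemma lintegral_rotateAboutMean_zero_le (hH : Differentiable ℂ H) (hα : 0 < α) :
    ∫⁻ x, ‖H (rotateAboutMean 0 x)‖ₑ ^ α ∂(Measure.pi fun _ : ι ↦ complexGaussian) ≤
      ∫⁻ x, ‖H x‖ₑ ^ α ∂(Measure.pi fun _ : ι ↦ complexGaussian) := by
  rw [← lintegral_circle_rotateAboutMean hH]
  exact lintegral_mono fun x ↦
    (enorm_rpow_submean (hH.comp (differentiable_rotateAboutMean x)) hα).1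

/-- Equality in the averaged sub-mean value property forces constant modulus. -/
lemma norm_eq_of_lintegral_le_rotateAboutMean_zero (hH : Differentiable ℂ H) (hα : 0 < α)
    (hle : ∫⁻ x, ‖H x‖ₑ ^ α ∂(Measure.pi fun _ : ι ↦ complexGaussian) ≤
      ∫⁻ x, ‖H (rotateAboutMean 0 x)‖ₑ ^ α ∂(Measure.pi fun _ : ι ↦ complexGaussian))
    (hfin : ∫⁻ x, ‖H x‖ₑ ^ α ∂(Measure.pi fun _ : ι ↦ complexGaussian) ≠ ∞)
    (x : ι → ℂ) (hx : H (rotateAboutMean 0 x) ≠ 0) :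
    ‖H x‖ = ‖H (rotateAboutMean 0 x)‖ := by
  have hP : Continuous fun x : ι → ℂ ↦ rotateAboutMean 0 x := by
    unfold rotateAboutMean; fun_prop
  have hcont : Continuous fun p : (ι → ℂ) × ℝ ↦
      H (rotateAboutMean (circleMap 0 1 p.2) p.1) :=
    hH.continuous.comp (continuous_rotateAboutMean_uncurry.comp
      (continuous_fst.prodMk ((continuous_circleMap 0 1).comp continuous_snd)))
  have hsub (x : ι → ℂ) := enorm_rpow_submean (hH.comp (differentiable_rotateAboutMean x)) hα
  have hae := ae_eq_of_ae_le_of_lintegral_le (Filter.Eventually.of_forall fun x ↦ (hsub x).1)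
    (ne_top_of_le_ne_top hfin (lintegral_rotateAboutMean_zero_le hH hα))
    ((hcont.measurable.enorm.pow_const α).lintegral_prod_right').aemeasurable
    ((lintegral_circle_rotateAboutMean hH).le.trans hle)
  have hzero : (fun x ↦ ‖H (rotateAboutMean 0 x)‖ * (‖H x‖ - ‖H (rotateAboutMean 0 x)‖))
      =ᵐ[Measure.pi fun _ : ι ↦ complexGaussian] fun _ ↦ 0 := by
    filter_upwards [hae] with x hx
    by_cases h0 : H (rotateAboutMean 0 x) = 0
    · simp only [h0, norm_zero, zero_mul]
    · have := (hsub x).2 hx.ge h0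
      simp only [Function.comp, rotateAboutMean_one] at this
      simp [this]
  have hall := Measure.eq_of_ae_eq hzero
    (((hH.continuous.comp hP).norm).mul (hH.continuous.norm.sub (hH.continuous.comp hP).norm))
    continuous_const
  have := (mul_eq_zero.1 (congrFun hall x)).resolve_left (norm_ne_zero_iff.2 hx)
  linarith

end RotationAveraging

section KeyInequality

open scoped ENNReal
open Real

/-- The `p`-th power of the `p`-Fock norm, as an integral against the standard Gaussian. -/
noncomputable def fockMass (f : ℂ → ℂ) (p : ℝ) : ℝ≥0∞ :=
  ∫⁻ w, ‖f ((√(2 / p) : ℝ) * w)‖ₑ ^ p ∂complexGaussian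

variable {ι : Type*} [Fintype ι]

lemma lintegral_sum_smul_complexGaussian {f : ℂ → ℂ} (hf : Differentiable ℂ f) {p : ℝ}
    (a : ι → ℝ) (ha : ∑ i, a i ^ 2 = 2 / p) (hp : 0 < p) :
    ∫⁻ x, ‖f (∑ i, (a i : ℂ) * x i)‖ₑ ^ p ∂(Measure.pi fun _ : ι ↦ complexGaussian) =
      fockMass f p := by
  have h2 : 0 < 2 / p := by positivity
  have hs : √(2 / p) ≠ 0 := (Real.sqrt_pos.2 h2).ne'
  have hb : ∑ i, (a i / √(2 / p)) ^ 2 = 1 := by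
    simp_rw [div_pow, Real.sq_sqrt h2.le, ← Finset.sum_div, ha, div_self h2.ne']
  have hm : Measurable fun w : ℂ ↦ ‖f ((√(2 / p) : ℝ) * w)‖ₑ ^ p :=
    (hf.continuous.comp (by fun_prop)).measurable.enorm.pow_const p
  have h := lintegral_map (μ := Measure.pi fun _ : ι ↦ complexGaussian) hm
    (g := fun x ↦ ∑ i, ((a i / √(2 / p) : ℝ) : ℂ) * x i) (by fun_prop)
  rw [map_sum_smul_complexGaussian _ hb] at h
  rw [fockMass, h]
  refine lintegral_congr fun x ↦ ?_
  congr 3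
  rw [Finset.mul_sum]
  refine Finset.sum_congr rfl fun i _ ↦ ?_
  rw [← mul_assoc, ← Complex.ofReal_mul, mul_div_cancel₀ _ hs]

variable [DecidableEq ι]

/-- The product over `i` of `f` evaluated at a multiple of the sum of all variables but the
`i`-th. -/
noncomputable def leaveOneOutProd (f : ℂ → ℂ) (c : ℝ) (x : ι → ℂ) : ℂ :=
  ∏ i, f (c * ∑ j ∈ Finset.univ.erase i, x j)

lemma differentiable_leaveOneOutProd {f : ℂ → ℂ} (hf : Differentiable ℂ f) (c : ℝ) :
    Differentiable ℂ (leaveOneOutProd f c : (ι → ℂ) → ℂ) := by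
  unfold leaveOneOutProd; fun_prop

lemma lintegral_leaveOneOutProd_le {f : ℂ → ℂ} (hf : Differentiable ℂ f) {p : ℝ} (hp : 0 < p)
    {n : ℝ} (hn : (Fintype.card ι : ℝ) = n) (hn1 : 1 < n) :
    ∫⁻ x : ι → ℂ, ‖leaveOneOutProd f (√(2 / (p * (n - 1)))) x‖ₑ ^ (p / (n - 1))
      ∂(Measure.pi fun _ : ι ↦ complexGaussian) ≤ fockMass f p ^ (n / (n - 1)) := by
  set c : ℝ := √(2 / (p * (n - 1))) with hc
  have hn0 : 0 < n - 1 := by linarith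
  have hcn : 0 ≤ 2 / (p * (n - 1)) := by positivity
  set F : ι → (ι → ℂ) → ℝ≥0∞ := fun i x ↦
    ‖f (c * ∑ j ∈ Finset.univ.erase i, x j)‖ₑ ^ p with hF
  have hFm (i : ι) : Measurable (F i) :=
    (hf.continuous.comp (by fun_prop)).measurable.enorm.pow_const p
  have hFd (i : ι) (x : ι → ℂ) (y : ℂ) : F i (Function.update x i y) = F i x := by
    simp only [hF]
    congr! 4
    refine Finset.sum_congr rfl fun j hj ↦ ?_
    rw [Function.update_of_ne (Finset.ne_of_mem_erase hj)]
  have hFi (i : ι) : ∫⁻ x, F i x ∂(Measure.pi fun _ : ι ↦ complexGaussian) = fockMass f p := by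
    rw [← lintegral_sum_smul_complexGaussian hf (fun j : ι ↦ if j = i then 0 else c) _ hp]
    · simp only [hF]
      refine lintegral_congr fun x ↦ ?_
      congr 3
      rw [← Finset.add_sum_erase _ _ (Finset.mem_univ i), Finset.mul_sum]
      simp only [if_true, Complex.ofReal_zero, zero_mul, zero_add]
      refine Finset.sum_congr rfl fun j hj ↦ ?_
      rw [if_neg (Finset.ne_of_mem_erase hj)]
    · rw [← Finset.add_sum_erase _ _ (Finset.mem_univ i),
        Finset.sum_congr (g := fun _ ↦ c ^ 2) rfl fun j hj ↦ by
          rw [if_neg (Finset.ne_of_mem_erase hj)],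
        Finset.sum_const, Finset.card_erase_of_mem (Finset.mem_univ i), nsmul_eq_mul,
        Finset.card_univ, Nat.cast_pred (Fintype.card_pos_iff.2 ⟨i⟩), hn, hc, Real.sq_sqrt hcn]
      simp; field_simp
  have := lintegral_prod_rpow_le_of_update (μ := complexGaussian) (c := 1 / (n - 1)) hFm hFd
    (by positivity) (by rw [hn]; field_simp)
  simp only [hFi, Finset.prod_const, Finset.card_univ] at this
  rw [← ENNReal.rpow_natCast, ← ENNReal.rpow_mul, hn, one_div_mul_eq_div] at this
  refine le_trans (le_of_eq ?_) this
  refine lintegral_congr fun x ↦ ?_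
  rw [leaveOneOutProd, enorm_eq_nnnorm, nnnorm_prod, ENNReal.ofNNReal_finsetProd,
    ← ENNReal.prod_rpow_of_nonneg (by positivity)]
  refine Finset.prod_congr rfl fun i _ ↦ ?_
  rw [← ENNReal.rpow_mul, mul_one_div, enorm_eq_nnnorm]

lemma lintegral_leaveOneOutProd_mean {f : ℂ → ℂ} (hf : Differentiable ℂ f) {p : ℝ} (hp : 0 < p)
    {n : ℝ} (hn : (Fintype.card ι : ℝ) = n) (hn1 : 1 < n) :
    ∫⁻ x : ι → ℂ, ‖leaveOneOutProd f (√(2 / (p * (n - 1)))) (rotateAboutMean 0 x)‖ₑ ^ (p / (n - 1))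
      ∂(Measure.pi fun _ : ι ↦ complexGaussian) = fockMass f (p * (n / (n - 1))) := by
  set c : ℝ := √(2 / (p * (n - 1))) with hc
  have hn0 : 0 < n - 1 := by linarith
  have hcn : 0 ≤ 2 / (p * (n - 1)) := by positivity
  rw [← lintegral_sum_smul_complexGaussian (ι := ι) hf (fun _ ↦ c * (n - 1) / n) _ (by positivity)]
  · refine lintegral_congr fun x ↦ ?_
    have hterm (i : ι) : (c : ℂ) * ∑ j ∈ Finset.univ.erase i, rotateAboutMean 0 x j =
        ∑ j, ((c * (n - 1) / n : ℝ) : ℂ) * x j := by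
      rw [rotateAboutMean_zero, Finset.sum_const, Finset.card_erase_of_mem (Finset.mem_univ i),
        nsmul_eq_mul, Finset.card_univ, Nat.cast_pred (Fintype.card_pos_iff.2 ⟨i⟩),
        ← Finset.mul_sum, ← hn]
      push_cast
      ring
    simp only [leaveOneOutProd, hterm]
    rw [Finset.prod_const, Finset.card_univ, enorm_pow, ← ENNReal.rpow_natCast,
      ← ENNReal.rpow_mul, hn]
    congr 1
    ring
  · rw [Finset.sum_const, Finset.card_univ, nsmul_eq_mul, hn, div_pow, mul_pow, hc,
      Real.sq_sqrt hcn]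
    field_simp

lemma fockMass_le_rpow {f : ℂ → ℂ} (hf : Differentiable ℂ f) {p : ℝ} (hp : 0 < p)
    {n : ℕ} (hn : 1 < n) :
    fockMass f (p * (n / (n - 1))) ≤ fockMass f p ^ ((n : ℝ) / (n - 1)) := by
  have hn1 : (1 : ℝ) < n := by exact_mod_cast hn
  have hn0 : (0 : ℝ) < n - 1 := by linarith
  have : Nonempty (Fin n) := ⟨⟨0, by omega⟩⟩
  have hcard : (Fintype.card (Fin n) : ℝ) = n := by simp
  rw [← lintegral_leaveOneOutProd_mean (ι := Fin n) hf hp hcard hn1]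
  exact (lintegral_rotateAboutMean_zero_le (differentiable_leaveOneOutProd hf _)
    (by positivity)).trans (lintegral_leaveOneOutProd_le hf hp hcard hn1)

lemma norm_leaveOneOutProd_eq {f : ℂ → ℂ} (hf : Differentiable ℂ f) {p : ℝ} (hp : 0 < p)
    {n : ℕ} (hn : 1 < n) (hfin : fockMass f p ≠ ∞)
    (heq : fockMass f p ^ ((n : ℝ) / (n - 1)) ≤ fockMass f (p * (n / (n - 1)))) (x : Fin n → ℂ)
    (hx : leaveOneOutProd f (√(2 / (p * (n - 1)))) (rotateAboutMean 0 x) ≠ 0) :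
    ‖leaveOneOutProd f (√(2 / (p * (n - 1)))) x‖ =
      ‖leaveOneOutProd f (√(2 / (p * (n - 1)))) (rotateAboutMean 0 x)‖ := by
  have hn1 : (1 : ℝ) < n := by exact_mod_cast hn
  have hn0 : (0 : ℝ) < n - 1 := by linarith
  have : Nonempty (Fin n) := ⟨⟨0, by omega⟩⟩
  have hcard : (Fintype.card (Fin n) : ℝ) = n := by simp
  have hle := lintegral_leaveOneOutProd_le (ι := Fin n) hf hp hcard hn1
  refine norm_eq_of_lintegral_le_rotateAboutMean_zero (α := p / (n - 1))
    (differentiable_leaveOneOutProd hf _) (by positivity) ?_ (ne_top_of_le_ne_top ?_ hle) x hx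
  · rw [lintegral_leaveOneOutProd_mean (ι := Fin n) hf hp hcard hn1]
    exact hle.trans heq
  · exact ENNReal.rpow_ne_top_of_nonneg (by positivity) hfin

end KeyInequality

section FockMass

open scoped ENNReal Topology
open Real Filter

lemma fockMass_rpow_le_natDiv {f : ℂ → ℂ} (hf : Differentiable ℂ f) {p : ℝ} (hp : 0 < p)
    {m n : ℕ} (hm : 0 < m) (hmn : m ≤ n) :
    fockMass f (p * (n / m)) ≤ fockMass f p ^ ((n : ℝ) / m) := by
  have hm' : (0 : ℝ) < m := by exact_mod_cast hm
  induction n, hmn using Nat.le_induction with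
  | base => simp [hm'.ne']
  | succ n hn ih =>
    have hn0 : 0 < n := hm.trans_le hn
    have hn' : (0 : ℝ) < n := by exact_mod_cast hn0
    have := fockMass_le_rpow hf (p := p * (n / m)) (by positivity) (n := n + 1) (by omega)
    have e : p * (n / m) * (((n + 1 : ℕ) : ℝ) / ((n + 1 : ℕ) - 1)) = p * ((n + 1 : ℕ) / m) := by
      push_cast; rw [add_sub_cancel_right]; field_simp
    have e' : (n : ℝ) / m * (((n + 1 : ℕ) : ℝ) / ((n + 1 : ℕ) - 1)) = (n + 1 : ℕ) / m := by
      push_cast; rw [add_sub_cancel_right]; field_simp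
    rw [e] at this
    refine this.trans ((ENNReal.rpow_le_rpow ih ?_).trans_eq ?_)
    · push_cast
      rw [add_sub_cancel_right]
      positivity
    · rw [← ENNReal.rpow_mul, e']

lemma fockMass_rpow_le_rat {f : ℂ → ℂ} (hf : Differentiable ℂ f) {p : ℝ} (hp : 0 < p)
    {r : ℚ} (hr : 1 ≤ r) : fockMass f (p * r) ≤ fockMass f p ^ (r : ℝ) := by
  have hden : (0 : ℚ) < r.den := by exact_mod_cast r.den_pos
  have hnum : 0 ≤ r.num := Rat.num_nonneg.2 (by linarith)
  obtain ⟨n, hn⟩ := Int.eq_ofNat_of_zero_le hnum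
  have hr' : r = n / r.den := by
    conv_lhs => rw [← Rat.num_div_den r, hn]
    simp
  have hle : r.den ≤ n := by
    rw [hr', one_le_div hden] at hr
    exact_mod_cast hr
  have hrr : (r : ℝ) = n / r.den := by
    conv_lhs => rw [hr']
    push_cast; rfl
  rw [hrr]
  exact fockMass_rpow_le_natDiv hf hp r.den_pos hle

lemma continuousAt_enorm_rpow_scaled {f : ℂ → ℂ} (hf : Continuous f) {p : ℝ} (hp : 0 < p)
    (w : ℂ) : ContinuousAt (fun r : ℝ ↦ ‖f ((√(2 / r) : ℝ) * w)‖ₑ ^ r) p := by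
  have h1 : ContinuousAt (fun r : ℝ ↦ ‖f ((√(2 / r) : ℝ) * w)‖) p := by
    have : ContinuousAt (fun r : ℝ ↦ 2 / r) p := continuousAt_const.div continuousAt_id hp.ne'
    have h2 : ContinuousAt (fun r : ℝ ↦ ((√(2 / r) : ℝ) : ℂ) * w) p :=
      (Complex.continuous_ofReal.continuousAt.comp
        (Real.continuous_sqrt.continuousAt.comp this)).mul continuousAt_const
    exact (hf.norm.continuousAt).comp (f := fun r : ℝ ↦ ((√(2 / r) : ℝ) : ℂ) * w) h2
  have h3 := ENNReal.continuous_ofReal.continuousAt.comp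
    (h1.rpow continuousAt_id (Or.inr hp))
  refine h3.congr ?_
  filter_upwards [lt_mem_nhds hp] with r hr
  simp only [Function.comp, id]
  rw [← ENNReal.ofReal_rpow_of_nonneg (norm_nonneg _) hr.le, ofReal_norm]

lemma measurable_enorm_rpow_scaled {f : ℂ → ℂ} (hf : Continuous f) (r : ℝ) :
    Measurable fun w : ℂ ↦ ‖f ((√(2 / r) : ℝ) * w)‖ₑ ^ r :=
  (hf.comp (by fun_prop)).measurable.enorm.pow_const r

lemma fockMass_rpow_le {f : ℂ → ℂ} (hf : Differentiable ℂ f) {p : ℝ} (hp : 0 < p)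
    {s : ℝ} (hs : 1 ≤ s) : fockMass f (p * s) ≤ fockMass f p ^ s := by
  rcases eq_or_ne (fockMass f p) ∞ with htop | hfin
  · rw [htop, ENNReal.top_rpow_of_pos (by linarith)]
    exact le_top
  obtain ⟨u, -, hu, hlim⟩ := Real.exists_seq_rat_strictAnti_tendsto s
  have hs0 : 0 < s := by linarith
  have hmul : Tendsto (fun k ↦ p * (u k : ℝ)) atTop (𝓝 (p * s)) := hlim.const_mul p
  have hrhs : Tendsto (fun k ↦ fockMass f p ^ (u k : ℝ)) atTop (𝓝 (fockMass f p ^ s)) := by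
    have := (ENNReal.continuous_ofReal.tendsto _).comp
      ((tendsto_const_nhds (x := (fockMass f p).toReal)).rpow hlim (Or.inr hs0))
    rw [← ENNReal.ofReal_rpow_of_nonneg ENNReal.toReal_nonneg hs0.le,
      ENNReal.ofReal_toReal hfin] at this
    refine this.congr fun k ↦ ?_
    simp only [Function.comp]
    rw [← ENNReal.ofReal_rpow_of_nonneg ENNReal.toReal_nonneg (hs0.trans (hu k)).le,
      ENNReal.ofReal_toReal hfin]
  calc fockMass f (p * s)
    _ = ∫⁻ w, liminf (fun k ↦ ‖f ((√(2 / (p * u k)) : ℝ) * w)‖ₑ ^ (p * u k : ℝ)) atTop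
          ∂complexGaussian := lintegral_congr fun w ↦ Eq.symm <| Tendsto.liminf_eq <|
            (continuousAt_enorm_rpow_scaled hf.continuous (by positivity) w).tendsto.comp hmul
    _ ≤ liminf (fun k ↦ fockMass f (p * u k)) atTop :=
        lintegral_liminf_le fun k ↦ measurable_enorm_rpow_scaled hf.continuous _
    _ ≤ liminf (fun k ↦ fockMass f p ^ (u k : ℝ)) atTop := by
        refine liminf_le_liminf (Eventually.of_forall fun k ↦ fockMass_rpow_le_rat hf hp ?_)
        exact_mod_cast hs.trans (hu k).le
    _ = fockMass f p ^ s := hrhs.liminf_eq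

/-- Equality at the exponent ratio `s` propagates to all smaller ratios. -/
lemma rpow_fockMass_le_of_le {f : ℂ → ℂ} (hf : Differentiable ℂ f) {p : ℝ} (hp : 0 < p)
    {s t : ℝ} (ht : 1 ≤ t) (hts : t ≤ s) (h : fockMass f p ^ s ≤ fockMass f (p * s)) :
    fockMass f p ^ t ≤ fockMass f (p * t) := by
  have ht0 : 0 < t := by linarith
  have hst : 1 ≤ s / t := (one_le_div ht0).2 hts
  have h1 := fockMass_rpow_le hf (p := p * t) (by positivity) hst
  have e : t * (s / t) = s := by field_simp
  rw [mul_assoc, e] at h1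
  rw [← ENNReal.rpow_le_rpow_iff (z := s / t) (by linarith), ← ENNReal.rpow_mul, e]
  exact h.trans h1

lemma fockMass_eq_lintegral {f : ℂ → ℂ} (hf : Continuous f) {r : ℝ} (hr : 0 < r) :
    fockMass f r = ENNReal.ofReal (r / 2) *
      ∫⁻ z : ℂ, ENNReal.ofReal (‖f z‖ ^ r * Real.exp (-r * Real.pi * ‖z‖ ^ 2 / 2)) := by
  set G : ℂ → ℝ≥0∞ := fun z ↦ ENNReal.ofReal (‖f z‖ ^ r * Real.exp (-r * Real.pi * ‖z‖ ^ 2 / 2))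
  have hGm : Measurable G := by
    have := hf.measurable
    fun_prop
  have h2 : 0 < 2 / r := by positivity
  have hs : √(2 / r) ≠ 0 := (Real.sqrt_pos.2 h2).ne'
  have h : fockMass f r = ∫⁻ w : ℂ, G (√(2 / r) • w) := by
    rw [fockMass, complexGaussian, lintegral_withDensity_eq_lintegral_mul _
      measurable_complexGaussian_density (measurable_enorm_rpow_scaled hf r)]
    refine lintegral_congr fun w ↦ ?_
    simp only [G, Pi.mul_apply]
    rw [Complex.real_smul, mul_comm, ENNReal.ofReal_mul (by positivity),
      ← ENNReal.ofReal_rpow_of_nonneg (norm_nonneg _) hr.le, ofReal_norm]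
    congr 3
    rw [norm_mul, mul_pow, Complex.norm_real, Real.norm_eq_abs, sq_abs, Real.sq_sqrt h2.le]
    field_simp
  rw [h, ← lintegral_map hGm (by fun_prop), Measure.map_addHaar_smul _ hs,
    lintegral_smul_measure, Complex.finrank_real_complex, Real.sq_sqrt h2.le, smul_eq_mul]
  congr 2
  rw [abs_of_pos (by positivity), inv_div]

lemma fockNorm_eq_fockMass {f : ℂ → ℂ} (hf : Continuous f) {r : ℝ} (hr : 0 < r) :
    fockNorm r f = (fockMass f r).toReal ^ (1 / r) := by
  have := hf.measurable
  rw [fockNorm, fockMass_eq_lintegral hf hr, ENNReal.toReal_mul,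
    ENNReal.toReal_ofReal (by positivity), integral_eq_lintegral_of_nonneg_ae]
  · exact Eventually.of_forall fun z ↦ by positivity
  · exact Measurable.aestronglyMeasurable (by fun_prop)

lemma fockMass_ne_top {f : ℂ → ℂ} (hf : Continuous f) {r : ℝ} (hr : 0 < r)
    (hint : Integrable (fun z : ℂ ↦ ‖f z‖ ^ r * Real.exp (-r * Real.pi * ‖z‖ ^ 2 / 2))) :
    fockMass f r ≠ ∞ := by
  rw [fockMass_eq_lintegral hf hr]
  exact ENNReal.mul_ne_top ENNReal.ofReal_ne_top hint.lintegral_lt_top.ne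

end FockMass

section ExponentialRigidity

lemma exists_eq_const_mul_exp_of_norm_mul {f : ℂ → ℂ} (hf : Differentiable ℂ f) (hne : f ≠ 0)
    (h : ∀ z u, f z ≠ 0 → ‖f (z + u) * f (z - u)‖ = ‖f z‖ ^ 2) :
    ∃ a b : ℂ, a ≠ 0 ∧ f = fun z ↦ a * Complex.exp (b * z) := by
  obtain ⟨z₀, hz₀⟩ := Function.ne_iff.1 hne
  have hnz (w : ℂ) : f w ≠ 0 := by
    intro hw
    have := h z₀ (w - z₀) hz₀
    rw [add_sub_cancel, hw, zero_mul, norm_zero] at this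
    exact pow_ne_zero 2 (norm_ne_zero_iff.2 hz₀) this.symm
  have hprod (z u : ℂ) : f (z + u) * f (z - u) = f z * f z := by
    have hd : Differentiable ℂ fun u ↦ f (z + u) * f (z - u) := by fun_prop
    have hb : Bornology.IsBounded (Set.range fun u ↦ f (z + u) * f (z - u)) :=
      isBounded_iff_forall_norm_le.2 ⟨‖f z‖ ^ 2, by
        rintro _ ⟨u, rfl⟩
        exact (h z u (hnz z)).le⟩
    simpa using hd.apply_eq_apply_of_bounded hb u 0
  have hadd (x y : ℂ) : f x * f y = f (x + y) * f 0 := by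
    have h1 := hprod ((x + y) / 2) ((x - y) / 2)
    have h2 := hprod ((x + y) / 2) ((x + y) / 2)
    rw [← h2] at h1
    convert h1 using 3 <;> ring
  set b := deriv f 0 / f 0 with hb
  have hderiv (x : ℂ) : deriv f x = b * f x := by
    have h1 : HasDerivAt (fun y ↦ f x * f y) (f x * deriv f 0) 0 :=
      (hf 0).hasDerivAt.const_mul _
    have h2 : HasDerivAt (fun y ↦ f (x + y) * f 0) (deriv f x * f 0) 0 := by
      refine HasDerivAt.mul_const ?_ _
      exact HasDerivAt.comp_const_add x 0 (by simpa using (hf x).hasDerivAt)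
    have h3 := (h1.congr_of_eventuallyEq (.of_forall fun y ↦ (hadd x y).symm)).unique h2
    rw [hb]
    have := hnz 0
    field_simp
    linear_combination -h3
  have hconst (z : ℂ) : f z * Complex.exp (-(b * z)) = f 0 := by
    have hd : Differentiable ℂ fun z ↦ f z * Complex.exp (-(b * z)) := by fun_prop
    have := is_const_of_deriv_eq_zero hd (fun x ↦ ?_) z 0
    · simpa using this
    · have he : HasDerivAt (fun z ↦ Complex.exp (-(b * z))) (Complex.exp (-(b * x)) * -(b * 1)) x :=
        ((hasDerivAt_id x).const_mul b).neg.cexp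
      have := ((hf x).hasDerivAt.mul he).deriv
      refine this.trans ?_
      rw [hderiv]
      ring
  refine ⟨f 0, b, hnz 0, funext fun z ↦ ?_⟩
  rw [← hconst z, mul_assoc, ← Complex.exp_add, neg_add_cancel, Complex.exp_zero, mul_one]

end ExponentialRigidity

section Equality

open scoped ENNReal
open Real

lemma norm_mul_eq_of_leaveOneOutProd {f : ℂ → ℂ} {c : ℝ} (hc : c ≠ 0) (n : ℕ)
    (h : ∀ x : Fin (n + 2) → ℂ, leaveOneOutProd f c (rotateAboutMean 0 x) ≠ 0 →
      ‖leaveOneOutProd f c x‖ = ‖leaveOneOutProd f c (rotateAboutMean 0 x)‖)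
    (z u : ℂ) (hz : f z ≠ 0) : ‖f (z + u) * f (z - u)‖ = ‖f z‖ ^ 2 := by
  have hc' : (c : ℂ) ≠ 0 := by exact_mod_cast hc
  have hn : (n : ℂ) + 1 ≠ 0 := by exact_mod_cast n.succ_ne_zero
  have hn2 : (n : ℂ) + 2 ≠ 0 := by exact_mod_cast (n + 1).succ_ne_zero
  set y : ℂ := z / (c * (n + 1)) with hy
  set x : Fin (n + 2) → ℂ := fun i ↦ y + if i = 0 then -(u / c) else if i = 1 then u / c else 0
    with hx
  have hsum : ∑ i, x i = (n + 2) * y := by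
    simp only [hx, Finset.sum_add_distrib, Fin.sum_univ_succ]
    simp [Fin.ext_iff]
    ring
  have hleave (x : Fin (n + 2) → ℂ) :
      leaveOneOutProd f c x = ∏ i, f (c * (∑ j, x j - x i)) := by
    simp only [leaveOneOutProd, Finset.sum_erase_eq_sub (Finset.mem_univ _)]
  have hmean : leaveOneOutProd f c (rotateAboutMean 0 x) = f z ^ (n + 2) := by
    rw [hleave, rotateAboutMean_zero, hsum]
    have e : (c : ℂ) * (((n : ℂ) + 2) * (((n : ℂ) + 2) * y / (n + 2)) -
        ((n : ℂ) + 2) * y / (n + 2)) = z := by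
      rw [hy]; field_simp; ring
    simp [e]
  have hval : leaveOneOutProd f c x = f (z + u) * f (z - u) * f z ^ n := by
    rw [hleave, hsum, Fin.prod_univ_succ, Fin.prod_univ_succ]
    have e0 : (c : ℂ) * (((n : ℂ) + 2) * y - x 0) = z + u := by
      simp only [hx, hy, if_true]; field_simp; ring
    have e1 : (c : ℂ) * (((n : ℂ) + 2) * y - x (Fin.succ 0)) = z - u := by
      have hx1 : x (Fin.succ 0) = y + u / c := by
        simp only [x]
        rw [if_neg (Fin.succ_ne_zero _), if_pos Fin.succ_zero_eq_one]
      rw [hx1, hy]; field_simp; ring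
    have e2 (i : Fin n) : (c : ℂ) * (((n : ℂ) + 2) * y - x i.succ.succ) = z := by
      have hxi : x i.succ.succ = y := by
        simp only [x]
        rw [if_neg (Fin.succ_ne_zero _), if_neg fun h ↦ Fin.succ_ne_zero i
          (Fin.succ_injective _ (h.trans Fin.succ_zero_eq_one.symm)), add_zero]
      rw [hxi, hy]; field_simp; ring
    simp only [e0, e1, e2, Finset.prod_const, Finset.card_univ, Fintype.card_fin]
    ring
  have key := h x (by rw [hmean]; exact pow_ne_zero _ hz)
  rw [hmean, hval, norm_mul, norm_pow, norm_pow, pow_add, mul_comm (_ ^ n)] at key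
  exact mul_right_cancel₀ (pow_ne_zero n (norm_ne_zero_iff.2 hz)) key

/-- Entire functions attaining equality between two Fock masses are exponentials. -/
lemma exists_eq_const_mul_exp_of_fockMass {f : ℂ → ℂ} (hf : Differentiable ℂ f) (hne : f ≠ 0)
    {p s : ℝ} (hp : 0 < p) (hs : 1 < s) (hfin : fockMass f p ≠ ∞)
    (h : fockMass f p ^ s ≤ fockMass f (p * s)) :
    ∃ a b : ℂ, a ≠ 0 ∧ f = fun z ↦ a * Complex.exp (b * z) := by
  obtain ⟨n, hn⟩ := exists_nat_gt (1 / (s - 1))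
  have hs0 : 0 < s - 1 := by linarith
  have hn0 : (0 : ℝ) ≤ n := n.cast_nonneg
  have ht : 1 ≤ ((n + 2 : ℕ) : ℝ) / ((n + 2 : ℕ) - 1) := by
    push_cast
    rw [one_le_div (by linarith)]
    linarith
  have hts : ((n + 2 : ℕ) : ℝ) / ((n + 2 : ℕ) - 1) ≤ s := by
    push_cast
    rw [div_lt_iff₀ hs0] at hn
    rw [div_le_iff₀ (by linarith)]
    nlinarith
  have hc : √(2 / (p * ((n + 2 : ℕ) - 1))) ≠ 0 := by
    refine (Real.sqrt_pos.2 (div_pos two_pos (mul_pos hp ?_))).ne'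
    push_cast
    linarith
  exact exists_eq_const_mul_exp_of_norm_mul hf hne <| norm_mul_eq_of_leaveOneOutProd hc n fun x ↦
    norm_leaveOneOutProd_eq hf hp (by omega) hfin (rpow_fockMass_le_of_le hf hp ht hts h) x

end Equality

section Optimizers

open Real

/-- The `p`-Fock norm of a normalised coherent state is that of its constant factor. -/
lemma fockNorm_const_mul_coherent {p : ℝ} (hp : 0 < p) (a w : ℂ) :
    fockNorm p (fun z ↦ a * Complex.exp (((-π * ‖w‖ ^ 2 / 2 : ℝ) : ℂ) +
      (π : ℂ) * (starRingEnd ℂ) w * z)) = ‖a‖ := by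
  have hpt (z : ℂ) : ‖a * Complex.exp (((-π * ‖w‖ ^ 2 / 2 : ℝ) : ℂ) +
      (π : ℂ) * (starRingEnd ℂ) w * z)‖ ^ p * Real.exp (-p * π * ‖z‖ ^ 2 / 2) =
      ‖a‖ ^ p * Real.exp (-(p * π / 2) * ‖z - w‖ ^ 2) := by
    rw [norm_mul, Complex.norm_exp, mul_rpow (norm_nonneg _) (Real.exp_nonneg _), ← Real.exp_mul,
      mul_assoc, ← Real.exp_add]
    congr 2
    simp only [Complex.sq_norm, Complex.normSq_apply, Complex.add_re, Complex.ofReal_re,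
      Complex.mul_re, Complex.mul_im, Complex.ofReal_im, Complex.conj_re, Complex.conj_im,
      Complex.sub_re, Complex.sub_im]
    ring
  simp_rw [fockNorm, hpt]
  rw [integral_const_mul,
    integral_sub_right_eq_self (fun z : ℂ ↦ Real.exp (-(p * π / 2) * ‖z‖ ^ 2)),
    GaussianFourier.integral_rexp_neg_mul_sq_norm (by positivity), Complex.finrank_real_complex]
  have hπ := Real.pi_ne_zero
  have e : p / 2 * (‖a‖ ^ p * (π / (p * π / 2)) ^ (((2 : ℕ) : ℝ) / 2)) = ‖a‖ ^ p := by
    norm_num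
    field_simp
  rw [e, ← rpow_mul (norm_nonneg _), mul_one_div_cancel hp.ne', rpow_one]

lemma const_mul_exp_eq_coherent (a b : ℂ) :
    ∃ a' w : ℂ, (a ≠ 0 → a' ≠ 0) ∧ (fun z ↦ a * Complex.exp (b * z)) =
      fun z ↦ a' * Complex.exp (((-π * ‖w‖ ^ 2 / 2 : ℝ) : ℂ) +
        (π : ℂ) * (starRingEnd ℂ) w * z) := by
  have hπ : (π : ℂ) ≠ 0 := by exact_mod_cast Real.pi_ne_zero
  set w : ℂ := (starRingEnd ℂ) b / π
  refine ⟨a * Complex.exp (-((-π * ‖w‖ ^ 2 / 2 : ℝ) : ℂ)), w,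
    fun ha ↦ mul_ne_zero ha (Complex.exp_ne_zero _), funext fun z ↦ ?_⟩
  have e : (π : ℂ) * (starRingEnd ℂ) w = b := by
    simp only [w, map_div₀, Complex.conj_conj, Complex.conj_ofReal]
    field_simp
  rw [mul_assoc, ← Complex.exp_add, neg_add_cancel_left, e]

end Optimizers

/-- **Carlen's reverse Hölder inequality in Fock space** (Corollary 4.2, Case 1).
For `0 < p < q < ∞` and entire `f` with `‖f‖_{F,p} < ∞`, one has `‖f‖_{F,q} ≤ ‖f‖_{F,p}`,
with equality if and only if `f = 0` or `‖f‖_{F,p}⁻¹ f ∈ M₁`. -/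
theorem reverse_holder_fock (p q : ℝ) (hp : 0 < p) (hpq : p < q) (f : ℂ → ℂ)
    (hf : Differentiable ℂ f)
    (hint : Integrable (fun z : ℂ => ‖f z‖ ^ p * Real.exp (-p * Real.pi * ‖z‖^2 / 2))) :
    fockNorm q f ≤ fockNorm p f ∧
    (fockNorm q f = fockNorm p f ↔
      f = 0 ∨ (fun z => ((fockNorm p f : ℝ) : ℂ)⁻¹ * f z) ∈ fockOpt) := by
  have hq : 0 < q := hp.trans hpq
  have hs : 1 < q / p := (one_lt_div hp).2 hpq
  have hps : p * (q / p) = q := mul_div_cancel₀ _ hp.ne'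
  have hfin := fockMass_ne_top hf.continuous hp hint
  have hmass : fockMass f q ≤ fockMass f p ^ (q / p) := by
    simpa only [hps] using fockMass_rpow_le hf hp hs.le
  have hfin' : fockMass f p ^ (q / p) ≠ ⊤ := ENNReal.rpow_ne_top_of_nonneg (by positivity) hfin
  have hroot : fockNorm p f = (fockMass f p ^ (q / p)).toReal ^ (1 / q) := by
    rw [fockNorm_eq_fockMass hf.continuous hp, ← ENNReal.toReal_rpow,
      ← Real.rpow_mul ENNReal.toReal_nonneg]
    congr 1
    field_simp
  refine ⟨?_, fun h ↦ ?_, ?_⟩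
  · rw [hroot, fockNorm_eq_fockMass hf.continuous hq]
    exact Real.rpow_le_rpow ENNReal.toReal_nonneg (ENNReal.toReal_mono hfin' hmass)
      (by positivity)
  · rw [or_iff_not_imp_left]
    intro hne
    rw [hroot, fockNorm_eq_fockMass hf.continuous hq,
      Real.rpow_left_inj ENNReal.toReal_nonneg ENNReal.toReal_nonneg (by positivity),
      ENNReal.toReal_eq_toReal_iff' (ne_top_of_le_ne_top hfin' hmass) hfin'] at h
    obtain ⟨a, b, ha, hab⟩ := exists_eq_const_mul_exp_of_fockMass hf hne hp hs hfin
      (by rw [hps, h])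
    obtain ⟨a', w, ha', hw⟩ := const_mul_exp_eq_coherent a b
    have hnorm : fockNorm p f = ‖a'‖ := by
      rw [hab, hw, fockNorm_const_mul_coherent hp]
    have hne0 : (‖a'‖ : ℂ) ≠ 0 := by exact_mod_cast norm_ne_zero_iff.2 (ha' ha)
    refine ⟨w, Complex.arg a', funext fun z ↦ ?_⟩
    rw [hnorm, hab.trans hw, ← mul_assoc]
    congr 1
    rw [inv_mul_eq_iff_eq_mul₀ hne0, mul_comm Complex.I, Complex.norm_mul_exp_arg_mul_I]
  · rintro (rfl | ⟨w, θ, hopt⟩)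
    · simp [fockNorm, hp.ne', hq.ne']
    · set N := fockNorm p f
      have hN : (N : ℂ) ≠ 0 := by
        intro h0
        have := congrFun hopt 0
        rw [h0, inv_zero, zero_mul] at this
        exact mul_ne_zero (Complex.exp_ne_zero _) (Complex.exp_ne_zero _) this.symm
      have hfeq : f = fun z ↦ (N * Complex.exp (Complex.I * θ)) *
          Complex.exp (((-Real.pi * ‖w‖ ^ 2 / 2 : ℝ) : ℂ) +
            (Real.pi : ℂ) * (starRingEnd ℂ) w * z) := by
        funext z
        rw [mul_assoc, ← congrFun hopt z, mul_inv_cancel_left₀ hN]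
      have hnorm (r : ℝ) (hr : 0 < r) : fockNorm r f = ‖(N : ℂ) * Complex.exp (Complex.I * θ)‖ := by
        rw [hfeq, fockNorm_const_mul_coherent hr]
      exact (hnorm q hq).trans (hnorm p hp).symm
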